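/- There exists a P-bilinear map σ : F₁ × F₂ → F₄ such that the P-bilinear map F₁ × F₃ → F₄, (x₁, x₃) ↦ ψ₃(x₁, x₃) − σ(x₁, d₃x₃), is a perfect pairing; that is, both induced P-linear maps F₁ → Hom_P(F₃, F₄), x₁ ↦ ψ₃(x₁,−) − σ(x₁, d₃(−)), and F₃ → Hom_P(F₁, F₄), x₃ ↦ ψ₃(−, x₃) − σ(−, d₃x₃), are isomorphisms. -/

import Mathlib

open QuadraticMap LinearMap Submodule Function

/-- A bilinear map with values in a free module of rank one that identifies `M` with the dual of a
reflexive module `N` also identifies `N` with the dual of `M`. -/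
theorem bijective_flip_of_bijective {R M N L : Type*} [CommRing R]
    [AddCommGroup M] [Module R M] [AddCommGroup N] [Module R N] [Module.IsReflexive R N]
    [AddCommGroup L] [Module R L] (e : L ≃ₗ[R] R) (B : M →ₗ[R] N →ₗ[R] L)
    (hB : Function.Bijective B) : Function.Bijective B.flip := by
  have hC : Function.Bijective (B.compr₂ e.toLinearMap) :=
    (e.congrRight (M := N)).bijective.comp hB
  have : (B.compr₂ e.toLinearMap).IsPerfPair := .of_bijective _ hC
  have hflip := IsPerfPair.bijective_right (B.compr₂ e.toLinearMap)
  exact ((e.congrRight (M := M)).bijective.of_comp_iff' B.flip).mp hflip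

/-- An isomorphism from `R` to the endomorphisms of a free module of rank one is multiplication by
a unit. -/
theorem exists_unit_smul_eq {R L : Type*} [CommRing R] [AddCommGroup L] [Module R L]
    (e : L ≃ₗ[R] R) (φ : R ≃ₗ[R] (L →ₗ[R] L)) :
    ∃ v : Rˣ, ∀ r y, v • φ r y = r • y := by
  have hφ (r y) : φ r y = r • φ 1 y := by
    conv_lhs => rw [← mul_one r, ← smul_eq_mul, map_smul, LinearMap.smul_apply]
  obtain ⟨v, hv⟩ := φ.surjective LinearMap.id
  have h1 (y) : v • φ 1 y = y := by rw [← hφ, hv, LinearMap.id_apply]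
  have hvw : v * e (φ 1 (e.symm 1)) = 1 := by
    simpa using congrArg e (h1 (e.symm 1))
  refine ⟨Units.mkOfMulEqOne _ _ hvw, fun r y => ?_⟩
  rw [Units.smul_def, Units.val_mkOfMulEqOne, hφ r y, smul_comm, h1]

theorem stmt_2
    (P : Type*) [CommRing P] [IsNoetherianRing P]
    (F1 F2 F3 F4 : Type*)
    [AddCommGroup F1] [Module P F1] [Module.Free P F1] [Module.Finite P F1]
    [AddCommGroup F2] [Module P F2] [Module.Free P F2] [Module.Finite P F2]
    [AddCommGroup F3] [Module P F3] [Module.Free P F3] [Module.Finite P F3]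
    [AddCommGroup F4] [Module P F4] [Module.Free P F4] [Module.Finite P F4]
    (d1 : F1 →ₗ[P] P) (d2 : F2 →ₗ[P] F1) (d3 : F3 →ₗ[P] F2) (d4 : F4 →ₗ[P] F3)
    (hd21 : ∀ x2, d1 (d2 x2) = 0) (hd32 : ∀ x3, d2 (d3 x3) = 0)
    (hd43 : ∀ x4, d3 (d4 x4) = 0)
    (hinj4 : Function.Injective d4)
    (hex3 : LinearMap.range d4 = LinearMap.ker d3)
    (hex2 : LinearMap.range d3 = LinearMap.ker d2)
    (hex1 : LinearMap.range d2 = LinearMap.ker d1)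
    (hrank : Nonempty (F4 ≃ₗ[P] P))
    (φ0 : P ≃ₗ[P] (F4 →ₗ[P] F4)) (φ1 : F1 ≃ₗ[P] (F3 →ₗ[P] F4))
    (φ2 : F2 ≃ₗ[P] (F2 →ₗ[P] F4)) (φ3 : F3 ≃ₗ[P] (F1 →ₗ[P] F4))
    (φ4 : F4 ≃ₗ[P] (P →ₗ[P] F4))
    (hφ1 : ∀ x1 y4, φ0 (d1 x1) y4 = φ1 x1 (d4 y4))
    (hφ2 : ∀ x2 y3, φ1 (d2 x2) y3 = φ2 x2 (d3 y3))
    (hφ3 : ∀ x3 y2, φ2 (d3 x3) y2 = φ3 x3 (d2 y2))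
    (hφ4 : ∀ x4 y1, φ3 (d4 x4) y1 = φ4 x4 (d1 y1))
    (ψ1d : F1 →ₗ[P] F1 →ₗ[P] F2) (hψ1alt : ∀ x1, ψ1d x1 x1 = 0)
    (ψ2d : F1 →ₗ[P] F2 →ₗ[P] F3)
    (ψ3 : F1 →ₗ[P] F3 →ₗ[P] F4)
    (ψ4 : QuadraticMap P F2 F4)
    (hA2 : ∀ x1 x4, ψ3 x1 (d4 x4) = d1 x1 • x4)
    (hA3 : ∀ x2 x3, polar ψ4 x2 (d3 x3) = - ψ3 (d2 x2) x3)
    (hnewb : ∀ x1 y1, d2 (ψ1d x1 y1) = d1 x1 • y1 - d1 y1 • x1)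
    (hbb : ∀ x1 x2, d3 (ψ2d x1 x2) = d1 x1 • x2 - ψ1d x1 (d2 x2))
    (hcc : ∀ x1 x3, d4 (ψ3 x1 x3) = d1 x1 • x3 - ψ2d x1 (d3 x3))
    (hdd : ∀ x2, d4 (ψ4 x2) = ψ2d (d2 x2) x2)
    : ∃ σ : F1 →ₗ[P] F2 →ₗ[P] F4,
      Function.Bijective (ψ3 - σ.compl₂ d3) ∧
      Function.Bijective (ψ3 - σ.compl₂ d3).flip := by
  obtain ⟨e⟩ := hrank
  obtain ⟨v, hv⟩ := exists_unit_smul_eq e φ0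
  let B : F1 →ₗ[P] F3 →ₗ[P] F4 := (v : P) • φ1.toLinearMap
  have hB : Function.Bijective B := (MulAction.bijective v).comp φ1.bijective
  let g : F1 →ₗ[P] F1 := φ1.symm.toLinearMap ∘ₗ (ψ3 - B)
  have hg (x1 x3) : φ1 (g x1) x3 = ψ3 x1 x3 - B x1 x3 := by simp [g]
  have hmem (x1) : g x1 ∈ LinearMap.range d2 := by
    rw [hex1, LinearMap.mem_ker]
    apply φ0.injective
    ext y4
    rw [hφ1, hg, hA2, map_zero, LinearMap.zero_apply, ← hv, hφ1]
    exact sub_self _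
  obtain ⟨h, hh⟩ := Module.projective_lifting_property d2.rangeRestrict
    (g.codRestrict _ hmem) d2.surjective_rangeRestrict
  have hd2 (x1) : d2 (h x1) = g x1 := congrArg Subtype.val (LinearMap.congr_fun hh x1)
  have key : ψ3 - (φ2.toLinearMap ∘ₗ h).compl₂ d3 = B := by
    ext x1 x3
    simp [← hφ2, hd2, hg]
  refine ⟨φ2.toLinearMap ∘ₗ h, ?_⟩
  rw [key]
  exact ⟨hB, bijective_flip_of_bijective e B hB⟩
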